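/- arXiv:1112.4226 — 2 statements merged into one kernel-verified Lean document; each statement's English description precedes it below -/
import Mathlib

section
/- Explicit evaluation of the Jacquet integral of a weight function: let δ ∈ {+1,−1}, ℓ ∈ ℤ, y > 0, and ν ∈ ℂ with Re ν > 0. Then ∫_{−∞}^{∞} e^{−2πiyξ} (ξ²+1)^{−ν−1/2} ((ξ−i)/(ξ+i))^{δℓ} dξ = (π^ν / Γ(ν+|ℓ|+1/2)) · Σ_{j=0}^{|ℓ|} (−π)^j · C(2|ℓ|,2j) · Γ(|ℓ|−j+1/2) · y^{ν+j} · ∫₀^{∞} t^{ν−1} (√t + δ·sgn(ℓ)/√t)^{2j} e^{−πy(t+1/t)} dt, where C(·,·) is the binomial coefficient, sgn is the sign function (for ℓ = 0 only the term j = 0 occurs and the sgn factor is absent), ((ξ−i)/(ξ+i))^{δℓ} is an integer power of a nonzero complex number, and (ξ²+1)^{−ν−1/2} and y^{ν+j}, t^{ν−1} are defined via the real logarithm of the positive base. Both sides converge absolutely. -/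
open MeasureTheory

theorem norm_cexp_neg_mul_add_mul_I_sq (a b x : ℝ) :
    ‖Complex.exp (-(b : ℂ) * ((x : ℂ) + a * Complex.I) ^ 2)‖ =
      Real.exp (b * a ^ 2) * Real.exp (-b * x ^ 2) := by
  rw [Complex.norm_exp, ← Real.exp_add]
  congr 1
  simp [pow_two]
  ring

theorem integrable_pow_mul_cexp_neg_mul_sq {b : ℝ} (hb : 0 < b) (a : ℝ) (n : ℕ) :
    Integrable (fun x : ℝ => ((x : ℂ) + a * Complex.I) ^ n *
      Complex.exp (-(b : ℂ) * ((x : ℂ) + a * Complex.I) ^ 2)) := by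
  simp only [add_pow _ _ n, Finset.sum_mul]
  rw [← Finset.sum_fn]
  refine integrable_finsetSum' _ fun k _ => ?_
  have h : Integrable fun x : ℝ => x ^ k * Real.exp (-b * x ^ 2) := by
    simpa using integrable_rpow_mul_exp_neg_mul_sq hb (s := k)
      (by linarith [(Nat.cast_nonneg k : (0 : ℝ) ≤ k)])
  refine Integrable.mono' (h.norm.mul_const
    (‖((a : ℂ) * Complex.I) ^ (n - k) * (n.choose k : ℂ)‖ * Real.exp (b * a ^ 2)))
    (by fun_prop) (.of_forall fun x => le_of_eq ?_)
  rw [norm_mul _ (Complex.exp _), norm_cexp_neg_mul_add_mul_I_sq]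
  simp only [norm_mul, norm_pow, Complex.norm_real, Real.norm_eq_abs, Real.abs_exp]
  ring

theorem integral_pow_add_two_mul_cexp_neg_mul_sq {b : ℝ} (hb : 0 < b) (a : ℝ) (n : ℕ) :
    2 * (b : ℂ) * ∫ x : ℝ, ((x : ℂ) + a * Complex.I) ^ (n + 2) *
        Complex.exp (-(b : ℂ) * ((x : ℂ) + a * Complex.I) ^ 2) =
      (n + 1) * ∫ x : ℝ, ((x : ℂ) + a * Complex.I) ^ n *
        Complex.exp (-(b : ℂ) * ((x : ℂ) + a * Complex.I) ^ 2) := by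
  have hI := integrable_pow_mul_cexp_neg_mul_sq hb a
  have key := integral_eq_zero_of_hasDerivAt_of_integrable
    (f := fun x : ℝ => ((x : ℂ) + a * Complex.I) ^ (n + 1) *
        Complex.exp (-(b : ℂ) * ((x : ℂ) + a * Complex.I) ^ 2))
    (f' := fun x : ℝ => (n + 1) * (((x : ℂ) + a * Complex.I) ^ n *
        Complex.exp (-(b : ℂ) * ((x : ℂ) + a * Complex.I) ^ 2)) -
      2 * b * (((x : ℂ) + a * Complex.I) ^ (n + 2) *
        Complex.exp (-(b : ℂ) * ((x : ℂ) + a * Complex.I) ^ 2)))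
    (fun x => by
      have h1 : HasDerivAt (fun x : ℝ => (x : ℂ) + a * Complex.I) 1 x :=
        Complex.ofRealCLM.hasDerivAt.add_const _
      have h := (h1.pow (n + 1)).mul ((h1.pow 2).const_mul (-(b : ℂ))).cexp
      refine h.congr_deriv ?_
      simp only [Pi.pow_apply, Nat.add_sub_cancel]
      push_cast
      ring)
    (((hI n).const_mul _).sub ((hI (n + 2)).const_mul _)) (hI (n + 1))
  rw [integral_sub ((hI n).const_mul _) ((hI (n + 2)).const_mul _),
    integral_const_mul, integral_const_mul] at key
  exact (sub_eq_zero.mp key).symm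

theorem integral_odd_pow_mul_cexp_neg_mul_sq {b : ℝ} (hb : 0 < b) (a : ℝ) (k : ℕ) :
    ∫ x : ℝ, ((x : ℂ) + a * Complex.I) ^ (2 * k + 1) *
      Complex.exp (-(b : ℂ) * ((x : ℂ) + a * Complex.I) ^ 2) = 0 := by
  have hb' : (b : ℂ) ≠ 0 := by exact_mod_cast hb.ne'
  induction k with
  | zero =>
    have hI := integrable_pow_mul_cexp_neg_mul_sq hb a
    have key := integral_eq_zero_of_hasDerivAt_of_integrable
      (f := fun x : ℝ => Complex.exp (-(b : ℂ) * ((x : ℂ) + a * Complex.I) ^ 2))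
      (f' := fun x : ℝ => (-2 * b) * (((x : ℂ) + a * Complex.I) ^ 1 *
        Complex.exp (-(b : ℂ) * ((x : ℂ) + a * Complex.I) ^ 2)))
      (fun x => by
        have h1 : HasDerivAt (fun x : ℝ => (x : ℂ) + a * Complex.I) 1 x :=
          Complex.ofRealCLM.hasDerivAt.add_const _
        refine ((h1.pow 2).const_mul (-(b : ℂ))).cexp.congr_deriv ?_
        simp only [Pi.pow_apply]
        push_cast
        ring)
      ((hI 1).const_mul _) (by simpa using hI 0)
    rw [integral_const_mul] at key
    simpa [hb'] using key
  | succ k ih =>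
    have h := integral_pow_add_two_mul_cexp_neg_mul_sq hb a (2 * k + 1)
    rw [ih, mul_zero, show 2 * k + 1 + 2 = 2 * (k + 1) + 1 by ring] at h
    simpa [hb'] using h

theorem integral_even_pow_mul_cexp_neg_mul_sq {b : ℝ} (hb : 0 < b) (a : ℝ) (k : ℕ) :
    ∫ x : ℝ, ((x : ℂ) + a * Complex.I) ^ (2 * k) *
      Complex.exp (-(b : ℂ) * ((x : ℂ) + a * Complex.I) ^ 2) =
        Complex.Gamma (k + 1 / 2) * (b : ℂ) ^ (-((k : ℂ) + 1 / 2)) := by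
  have hb' : (b : ℂ) ≠ 0 := by exact_mod_cast hb.ne'
  induction k with
  | zero =>
    have h := GaussianFourier.integral_cexp_neg_mul_sq_add_real_mul_I (b := b) (by simpa) a
    simp only [mul_zero, pow_zero, one_mul, h, Nat.cast_zero, zero_add]
    rw [Complex.Gamma_one_half_eq, Complex.cpow_neg, ← div_eq_mul_inv, ← Complex.ofReal_div,
      div_eq_mul_inv, Complex.ofReal_mul, Complex.mul_cpow_ofReal_nonneg Real.pi_pos.le
      (by positivity), Complex.ofReal_inv, Complex.inv_cpow, div_eq_mul_inv]
    · exact (div_eq_mul_inv _ _).symm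
    · rw [Complex.arg_ofReal_of_nonneg hb.le]
      exact Real.pi_pos.ne
  | succ k ih =>
    have h := integral_pow_add_two_mul_cexp_neg_mul_sq hb a (2 * k)
    rw [ih] at h
    have hk : (k : ℂ) + 1 / 2 ≠ 0 := by
      intro h0
      have := congrArg Complex.re h0
      norm_num at this
      linarith [(Nat.cast_nonneg k : (0 : ℝ) ≤ k)]
    have hp : (b : ℂ) ^ (-((k : ℂ) + 1 / 2 + 1)) = (b : ℂ) ^ (-((k : ℂ) + 1 / 2)) * (b : ℂ)⁻¹ := by
      rw [neg_add _ (1 : ℂ), Complex.cpow_add _ _ hb', Complex.cpow_neg_one]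
    refine mul_left_cancel₀ (mul_ne_zero two_ne_zero hb') ?_
    rw [show 2 * (k + 1) = 2 * k + 2 by ring, h,
      show (((k + 1 : ℕ) : ℂ) + 1 / 2) = (k + 1 / 2) + 1 by push_cast; ring,
      Complex.Gamma_add_one _ hk, hp]
    push_cast
    field_simp

theorem sum_range_eq_sum_even {M : Type*} [AddCommMonoid M] (f : ℕ → M) (L : ℕ)
    (hf : ∀ k < L, f (2 * k + 1) = 0) :
    ∑ m ∈ Finset.range (2 * L + 1), f m = ∑ j ∈ Finset.range (L + 1), f (2 * j) := by
  induction L with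
  | zero => simp
  | succ n ih =>
    rw [show 2 * (n + 1) + 1 = 2 * n + 1 + 1 + 1 by ring, Finset.sum_range_succ,
      Finset.sum_range_succ, ih fun k hk => hf k (hk.trans n.lt_succ_self), hf n n.lt_succ_self,
      add_zero, Finset.sum_range_succ _ (n + 1)]
    rfl

theorem integral_cexp_mul_pow_mul_gaussian {t : ℝ} (ht : 0 < t) (y E : ℝ) (L : ℕ) :
    ∫ ξ : ℝ, Complex.exp (-2 * (Real.pi : ℂ) * Complex.I * (y : ℂ) * (ξ : ℂ)) *
        ((ξ : ℂ) - E * Complex.I) ^ (2 * L) * Complex.exp (-(Real.pi * t * ξ ^ 2 : ℝ)) =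
      ∑ j ∈ Finset.range (L + 1), ((2 * L).choose (2 * j) : ℂ) * (-1) ^ j *
        ((y / t + E) ^ (2 * j) : ℝ) * Complex.Gamma ((L : ℂ) - j + 1 / 2) *
        ((Real.pi * t : ℝ) : ℂ) ^ (-((L : ℂ) - j + 1 / 2)) *
          Complex.exp (-(Real.pi * y ^ 2 / t : ℝ)) := by
  have hb : 0 < Real.pi * t := mul_pos Real.pi_pos ht
  have ht' : (t : ℂ) ≠ 0 := by exact_mod_cast ht.ne'
  set c : ℂ := Complex.exp (-(Real.pi * y ^ 2 / t : ℝ)) with hc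
  set J : ℕ → ℝ → ℂ := fun n ξ => ((ξ : ℂ) + (y / t : ℝ) * Complex.I) ^ n *
      Complex.exp (-((Real.pi * t : ℝ) : ℂ) * ((ξ : ℂ) + (y / t : ℝ) * Complex.I) ^ 2) with hJ
  have hint : ∀ ξ : ℝ, Complex.exp (-2 * (Real.pi : ℂ) * Complex.I * (y : ℂ) * (ξ : ℂ)) *
        ((ξ : ℂ) - E * Complex.I) ^ (2 * L) * Complex.exp (-(Real.pi * t * ξ ^ 2 : ℝ)) =
      ∑ m ∈ Finset.range (2 * L + 1), (((2 * L).choose m : ℂ) *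
        (-((y / t + E : ℝ) * Complex.I)) ^ m * c) * J (2 * L - m) ξ := by
    intro ξ
    have h1 : ((ξ : ℂ) - E * Complex.I) = -((y / t + E : ℝ) * Complex.I) +
        ((ξ : ℂ) + (y / t : ℝ) * Complex.I) := by
      push_cast; ring
    have h2 : Complex.exp (-2 * (Real.pi : ℂ) * Complex.I * (y : ℂ) * (ξ : ℂ)) *
        Complex.exp (-(Real.pi * t * ξ ^ 2 : ℝ)) = c *
        Complex.exp (-((Real.pi * t : ℝ) : ℂ) * ((ξ : ℂ) + (y / t : ℝ) * Complex.I) ^ 2) := by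
      rw [hc, ← Complex.exp_add, ← Complex.exp_add]
      congr 1
      push_cast
      field_simp
      ring_nf
      simp only [Complex.I_sq]
      ring
    rw [mul_right_comm, h2, h1, add_pow _ _ (2 * L), Finset.mul_sum]
    refine Finset.sum_congr rfl fun m _ => ?_
    simp only [J]
    ring
  simp only [hint]
  rw [integral_finsetSum _ fun m _ =>
    (integrable_pow_mul_cexp_neg_mul_sq hb (y / t) (2 * L - m)).const_mul _]
  simp only [integral_const_mul]
  rw [sum_range_eq_sum_even (M := ℂ)]
  · refine Finset.sum_congr rfl fun j hj => ?_
    have hj' : j ≤ L := Nat.lt_succ_iff.mp (Finset.mem_range.mp hj)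
    rw [show 2 * L - 2 * j = 2 * (L - j) by omega]
    rw [integral_even_pow_mul_cexp_neg_mul_sq hb, Nat.cast_sub hj', pow_mul (-_), neg_sq,
      mul_pow, Complex.I_sq, mul_pow, ← pow_mul]
    push_cast
    ring
  · intro k hk
    rw [show 2 * L - (2 * k + 1) = 2 * (L - k - 1) + 1 by omega]
    rw [integral_odd_pow_mul_cexp_neg_mul_sq hb, mul_zero]

theorem integrableOn_rpow_mul_exp_neg_mul {a r : ℝ} (ha : 0 < a) (hr : 0 < r) :
    IntegrableOn (fun t : ℝ => t ^ (a - 1) * Real.exp (-(r * t))) (Set.Ioi 0) := by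
  simpa using integrableOn_rpow_mul_exp_neg_mul_rpow (s := a - 1) (p := 1) (b := r)
    (by linarith) one_pos hr

theorem integrableOn_cpow_mul_sqrt_add_pow_mul_exp {ν : ℂ} (hν : 0 < ν.re) {c : ℝ} (hc : 0 < c)
    {E : ℝ} (hE : |E| ≤ 1) (j : ℕ) :
    IntegrableOn (fun t : ℝ => (t : ℂ) ^ (ν - 1) *
      (((Real.sqrt t + E / Real.sqrt t) ^ (2 * j) : ℝ) : ℂ) *
      (Real.exp (-(c * (t + 1 / t))) : ℂ)) (Set.Ioi 0) := by
  have h := (integrableOn_rpow_mul_exp_neg_mul hν (half_pos hc)).const_mul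
    ((4 / c) ^ j * (j.factorial : ℝ))
  refine Integrable.mono' h ?_ ?_
  · refine Measurable.aestronglyMeasurable ?_
    fun_prop
  · refine (ae_restrict_iff' measurableSet_Ioi).mpr (.of_forall fun t (ht : 0 < t) => ?_)
    have hs : 0 < √t := Real.sqrt_pos.mpr ht
    rw [norm_mul, norm_mul, Complex.norm_cpow_eq_rpow_re_of_pos ht, Complex.norm_real,
      Complex.norm_real, Real.norm_eq_abs, Real.norm_eq_abs, Real.abs_exp, pow_mul,
      abs_of_nonneg (by positivity : 0 ≤ ((√t + E / √t) ^ 2) ^ j), Complex.sub_re, Complex.one_re]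
    have hE' := abs_le.mp hE
    have hw : 2 ≤ t + 1 / t := by
      have : t + 1 / t - 2 = (t - 1) ^ 2 / t := by field_simp; ring
      have : 0 ≤ (t - 1) ^ 2 / t := by positivity
      linarith
    have h1 : (√t + E / √t) ^ 2 ≤ 2 * (t + 1 / t) := by
      have : (√t + E / √t) ^ 2 = t + 2 * E + E ^ 2 * (1 / t) := by
        rw [add_sq, div_pow, Real.sq_sqrt ht.le]
        field_simp
      have : E ^ 2 * (1 / t) ≤ 1 * (1 / t) := by
        gcongr
        nlinarith
      linarith
    have h2 := Real.pow_div_factorial_le_exp (c / 2 * (t + 1 / t)) (by positivity) j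
    rw [div_le_iff₀ (by positivity)] at h2
    have h3 : ((√t + E / √t) ^ 2) ^ j ≤
        (4 / c) ^ j * (Real.exp (c / 2 * (t + 1 / t)) * j.factorial) := by
      calc ((√t + E / √t) ^ 2) ^ j ≤ (2 * (t + 1 / t)) ^ j := by gcongr
        _ = (4 / c) ^ j * (c / 2 * (t + 1 / t)) ^ j := by
          rw [← mul_pow]
          congr 1
          field_simp
          ring
        _ ≤ _ := by gcongr
    have h4 : Real.exp (c / 2 * (t + 1 / t)) * Real.exp (-(c * (t + 1 / t))) ≤
        Real.exp (-(c / 2 * t)) := by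
      rw [← Real.exp_add]
      gcongr
      have : 0 < c / 2 * (1 / t) := by positivity
      linarith
    calc t ^ (ν.re - 1) * ((√t + E / √t) ^ 2) ^ j * Real.exp (-(c * (t + 1 / t)))
        ≤ t ^ (ν.re - 1) * ((4 / c) ^ j * (Real.exp (c / 2 * (t + 1 / t)) * j.factorial)) *
          Real.exp (-(c * (t + 1 / t))) := by gcongr
      _ = (4 / c) ^ j * j.factorial * (t ^ (ν.re - 1) *
          (Real.exp (c / 2 * (t + 1 / t)) * Real.exp (-(c * (t + 1 / t))))) := by ring
      _ ≤ _ := by gcongr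

theorem integrable_sq_add_one_rpow {a : ℝ} (ha : 0 < a) :
    Integrable fun ξ : ℝ => (ξ ^ 2 + 1) ^ (-a - 1 / 2) := by
  have h := integrable_rpow_neg_one_add_norm_sq (E := ℝ) (μ := volume) (r := 2 * a + 1)
    (by simp; linarith)
  refine h.congr (.of_forall fun ξ => ?_)
  simp only [Real.norm_eq_abs, sq_abs]
  rw [add_comm]
  congr 1
  ring

theorem norm_cexp_neg_two_pi_I_mul (y ξ : ℝ) :
    ‖Complex.exp (-2 * (Real.pi : ℂ) * Complex.I * (y : ℂ) * (ξ : ℂ))‖ = 1 := by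
  rw [Complex.norm_exp]
  simp

theorem integrable_prod_cexp_mul_pow_mul_cpow {ν : ℂ} (hν : 0 < ν.re) (y : ℝ) {E : ℝ}
    (hE : |E| ≤ 1) (L : ℕ) :
    Integrable (Function.uncurry fun ξ t : ℝ =>
      Complex.exp (-2 * (Real.pi : ℂ) * Complex.I * (y : ℂ) * (ξ : ℂ)) *
        ((ξ : ℂ) - E * Complex.I) ^ (2 * L) *
        ((t : ℂ) ^ (ν + L + 1 / 2 - 1) *
          Complex.exp (-(((Real.pi * (ξ ^ 2 + 1) : ℝ) : ℂ) * t))))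
      ((volume : Measure ℝ).prod (volume.restrict (Set.Ioi 0))) := by
  set a : ℝ := ν.re + L + 1 / 2 with ha
  have ha0 : 0 < a := by positivity
  have hr : ∀ ξ : ℝ, 0 < Real.pi * (ξ ^ 2 + 1) := fun ξ => by positivity
  have hnorm : ∀ ξ : ℝ, ∀ t ∈ Set.Ioi (0 : ℝ),
      ‖Complex.exp (-2 * (Real.pi : ℂ) * Complex.I * (y : ℂ) * (ξ : ℂ)) *
        ((ξ : ℂ) - E * Complex.I) ^ (2 * L) *
        ((t : ℂ) ^ (ν + L + 1 / 2 - 1) *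
          Complex.exp (-(((Real.pi * (ξ ^ 2 + 1) : ℝ) : ℂ) * t)))‖ =
      (ξ ^ 2 + E ^ 2) ^ L * (t ^ (a - 1) * Real.exp (-(Real.pi * (ξ ^ 2 + 1) * t))) := by
    intro ξ t ht
    have h1 : ‖(ξ : ℂ) - E * Complex.I‖ ^ 2 = ξ ^ 2 + E ^ 2 := by
      rw [← Complex.normSq_eq_norm_sq, Complex.normSq_apply]
      simp
      ring
    rw [norm_mul, norm_mul, norm_mul, norm_cexp_neg_two_pi_I_mul, norm_pow, pow_mul, h1,
      Complex.norm_cpow_eq_rpow_re_of_pos ht, one_mul, Complex.norm_exp]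
    congr 3
    · simp [ha]
    · rw [← Complex.ofReal_mul, ← Complex.ofReal_neg, Complex.ofReal_re]
  have hmeas : AEStronglyMeasurable (Function.uncurry fun ξ t : ℝ =>
      Complex.exp (-2 * (Real.pi : ℂ) * Complex.I * (y : ℂ) * (ξ : ℂ)) *
        ((ξ : ℂ) - E * Complex.I) ^ (2 * L) *
        ((t : ℂ) ^ (ν + L + 1 / 2 - 1) *
          Complex.exp (-(((Real.pi * (ξ ^ 2 + 1) : ℝ) : ℂ) * t))))
      ((volume : Measure ℝ).prod (volume.restrict (Set.Ioi 0))) := by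
    refine Measurable.aestronglyMeasurable ?_
    unfold Function.uncurry
    fun_prop
  refine (integrable_prod_iff hmeas).mpr ⟨.of_forall fun ξ => ?_, ?_⟩
  · refine Integrable.mono' (((integrableOn_rpow_mul_exp_neg_mul ha0 (hr ξ)).const_mul
      ((ξ ^ 2 + E ^ 2) ^ L))) (Measurable.aestronglyMeasurable ?_)
      ((ae_restrict_iff' measurableSet_Ioi).mpr (.of_forall fun t ht => (hnorm ξ t ht).le))
    simp only [Function.uncurry]
    fun_prop
  · simp only [Function.uncurry]
    have heq : ∀ ξ : ℝ, ∫ t in Set.Ioi (0 : ℝ),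
        ‖Complex.exp (-2 * (Real.pi : ℂ) * Complex.I * (y : ℂ) * (ξ : ℂ)) *
        ((ξ : ℂ) - E * Complex.I) ^ (2 * L) *
        ((t : ℂ) ^ (ν + L + 1 / 2 - 1) *
          Complex.exp (-(((Real.pi * (ξ ^ 2 + 1) : ℝ) : ℂ) * t)))‖ =
        (ξ ^ 2 + E ^ 2) ^ L * ((1 / (Real.pi * (ξ ^ 2 + 1))) ^ a * Real.Gamma a) := by
      intro ξ
      rw [setIntegral_congr_fun measurableSet_Ioi (hnorm ξ), integral_const_mul,
        Real.integral_rpow_mul_exp_neg_mul_Ioi ha0 (hr ξ)]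
    simp only [heq]
    refine Integrable.mono' ((integrable_sq_add_one_rpow hν).const_mul
      ((1 / Real.pi) ^ a * Real.Gamma a)) (Measurable.aestronglyMeasurable (by fun_prop))
      (.of_forall fun ξ => ?_)
    have hG := Real.Gamma_pos_of_pos ha0
    have hE2 : E ^ 2 ≤ 1 := (sq_le_one_iff_abs_le_one E).mpr hE
    have hX : 0 < ξ ^ 2 + 1 := by positivity
    rw [Real.norm_of_nonneg (by positivity), one_div, mul_inv, ← one_div Real.pi,
      Real.mul_rpow (by positivity) (by positivity), Real.inv_rpow hX.le, ← Real.rpow_neg hX.le]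
    calc (ξ ^ 2 + E ^ 2) ^ L * ((1 / Real.pi) ^ a * (ξ ^ 2 + 1) ^ (-a) * Real.Gamma a)
        ≤ (ξ ^ 2 + 1) ^ L * ((1 / Real.pi) ^ a * (ξ ^ 2 + 1) ^ (-a) * Real.Gamma a) := by gcongr
      _ = (1 / Real.pi) ^ a * Real.Gamma a * ((ξ ^ 2 + 1) ^ (L : ℝ) * (ξ ^ 2 + 1) ^ (-a)) := by
        rw [Real.rpow_natCast]; ring
      _ = _ := by
        rw [← Real.rpow_add hX]
        congr 2
        rw [ha]; ring

theorem sqrt_add_div_sqrt_pow_two_mul {t : ℝ} (ht : 0 < t) {E : ℝ} {j : ℕ}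
    (hE : j = 0 ∨ E ^ 2 = 1) :
    (Real.sqrt t + E / Real.sqrt t) ^ (2 * j) = t ^ j * (1 / t + E) ^ (2 * j) := by
  rcases hE with rfl | hE
  · simp
  have hs : √t ≠ 0 := (Real.sqrt_pos.mpr ht).ne'
  rw [pow_mul, pow_mul, ← mul_pow, add_sq, div_pow, Real.sq_sqrt ht.le, hE]
  congr 1
  field_simp
  linear_combination -(t ^ 2) * hE

theorem integral_cexp_mul_cpow_mul_pow {ν : ℂ} (hν : 0 < ν.re) {y : ℝ} (hy : 0 < y) {E : ℝ}
    (hE : |E| ≤ 1) (L : ℕ) (hEL : L = 0 ∨ E ^ 2 = 1) :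
    ∫ ξ : ℝ, Complex.exp (-2 * (Real.pi : ℂ) * Complex.I * (y : ℂ) * (ξ : ℂ)) *
        (((ξ ^ 2 + 1 : ℝ) : ℂ) ^ (-(ν + L + 1 / 2)) * ((ξ : ℂ) - E * Complex.I) ^ (2 * L)) =
      (Real.pi : ℂ) ^ ν / Complex.Gamma (ν + L + 1 / 2) *
        ∑ j ∈ Finset.range (L + 1),
          (-(Real.pi : ℂ)) ^ j * ((2 * L).choose (2 * j) : ℂ) *
            Complex.Gamma ((L : ℂ) - j + 1 / 2) * (y : ℂ) ^ (ν + j) *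
            ∫ t in Set.Ioi (0 : ℝ), (t : ℂ) ^ (ν - 1) *
              (((Real.sqrt t + E / Real.sqrt t) ^ (2 * j) : ℝ) : ℂ) *
              (Real.exp (-(Real.pi * y * (t + 1 / t))) : ℂ) := by
  set s : ℂ := ν + L + 1 / 2 with hs
  have hs0 : 0 < s.re := by
    simp only [hs, Complex.add_re, Complex.natCast_re]
    norm_num
    positivity
  have hG : Complex.Gamma s ≠ 0 := Complex.Gamma_ne_zero_of_re_pos hs0
  have hpi : (Real.pi : ℂ) ≠ 0 := by exact_mod_cast Real.pi_pos.ne'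
  have hy' : (y : ℂ) ≠ 0 := by exact_mod_cast hy.ne'
  have hint : ∀ ξ : ℝ, Complex.exp (-2 * (Real.pi : ℂ) * Complex.I * (y : ℂ) * (ξ : ℂ)) *
        (((ξ ^ 2 + 1 : ℝ) : ℂ) ^ (-s) * ((ξ : ℂ) - E * Complex.I) ^ (2 * L)) =
      (Real.pi : ℂ) ^ s / Complex.Gamma s * ∫ t in Set.Ioi (0 : ℝ),
        Complex.exp (-2 * (Real.pi : ℂ) * Complex.I * (y : ℂ) * (ξ : ℂ)) *
        ((ξ : ℂ) - E * Complex.I) ^ (2 * L) *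
        ((t : ℂ) ^ (s - 1) * Complex.exp (-(((Real.pi * (ξ ^ 2 + 1) : ℝ) : ℂ) * t))) := by
    intro ξ
    have hr : 0 < Real.pi * (ξ ^ 2 + 1) := by positivity
    have hX : 0 < ξ ^ 2 + 1 := by positivity
    have harg : ((Real.pi * (ξ ^ 2 + 1) : ℝ) : ℂ).arg ≠ Real.pi := by
      rw [Complex.arg_ofReal_of_nonneg hr.le]
      exact Real.pi_pos.ne
    rw [integral_const_mul, Complex.integral_cpow_mul_exp_neg_mul_Ioi hs0 hr, one_div,
      Complex.inv_cpow _ _ harg, Complex.ofReal_mul,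
      Complex.mul_cpow_ofReal_nonneg Real.pi_pos.le hX.le, Complex.cpow_neg]
    have h1 : (Real.pi : ℂ) ^ s ≠ 0 := by simp [Complex.cpow_eq_zero_iff, hpi]
    field_simp
  simp only [hint]
  rw [integral_const_mul, integral_integral_swap (integrable_prod_cexp_mul_pow_mul_cpow hν y hE L)]
  set g : ℝ → ℂ := fun t => ∑ j ∈ Finset.range (L + 1), (t : ℂ) ^ (s - 1) *
    Complex.exp (-(Real.pi * t : ℝ)) * (((2 * L).choose (2 * j) : ℂ) * (-1) ^ j *
        ((y / t + E) ^ (2 * j) : ℝ) * Complex.Gamma ((L : ℂ) - j + 1 / 2) *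
        ((Real.pi * t : ℝ) : ℂ) ^ (-((L : ℂ) - j + 1 / 2)) *
          Complex.exp (-(Real.pi * y ^ 2 / t : ℝ))) with hg
  have hinner : ∀ t ∈ Set.Ioi (0 : ℝ), ∫ ξ : ℝ,
        Complex.exp (-2 * (Real.pi : ℂ) * Complex.I * (y : ℂ) * (ξ : ℂ)) *
        ((ξ : ℂ) - E * Complex.I) ^ (2 * L) *
        ((t : ℂ) ^ (s - 1) * Complex.exp (-(((Real.pi * (ξ ^ 2 + 1) : ℝ) : ℂ) * t))) = g t := by
    intro t ht
    simp only [hg]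
    rw [← Finset.mul_sum, ← integral_cexp_mul_pow_mul_gaussian ht, ← integral_const_mul]
    congr 1
    ext ξ
    have : Complex.exp (-(((Real.pi * (ξ ^ 2 + 1) : ℝ) : ℂ) * t)) =
        Complex.exp (-(Real.pi * t : ℝ)) * Complex.exp (-(Real.pi * t * ξ ^ 2 : ℝ)) := by
      rw [← Complex.exp_add]
      congr 1
      push_cast
      ring
    rw [this]
    ring
  rw [setIntegral_congr_fun measurableSet_Ioi hinner]
  have hsubst : ∫ t in Set.Ioi (0 : ℝ), g t = ∫ t in Set.Ioi (0 : ℝ), (y : ℂ) * g (y * t) := by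
    rw [integral_const_mul, integral_comp_mul_left_Ioi g 0 hy, mul_zero, Complex.real_smul,
      Complex.ofReal_inv, mul_inv_cancel_left₀ hy']
  have hpt : ∀ t ∈ Set.Ioi (0 : ℝ), (y : ℂ) * g (y * t) =
      ∑ j ∈ Finset.range (L + 1), ((Real.pi : ℂ) ^ (-((L : ℂ) + 1 / 2)) *
        ((-(Real.pi : ℂ)) ^ j * ((2 * L).choose (2 * j) : ℂ) *
            Complex.Gamma ((L : ℂ) - j + 1 / 2) * (y : ℂ) ^ (ν + j))) *
        ((t : ℂ) ^ (ν - 1) * (((Real.sqrt t + E / Real.sqrt t) ^ (2 * j) : ℝ) : ℂ) *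
              (Real.exp (-(Real.pi * y * (t + 1 / t))) : ℂ)) := by
    intro t (ht : 0 < t)
    have ht' : (t : ℂ) ≠ 0 := by exact_mod_cast ht.ne'
    simp only [hg]
    rw [Finset.mul_sum]
    refine Finset.sum_congr rfl fun j hj => ?_
    have hjE : j = 0 ∨ E ^ 2 = 1 := hEL.imp_left fun h => by
      have := Finset.mem_range.mp hj
      omega
    have hexp : (Real.exp (-(Real.pi * y * (t + 1 / t))) : ℂ) =
        Complex.exp (-(Real.pi * (y * t) : ℝ)) *
          Complex.exp (-(Real.pi * y ^ 2 / (y * t) : ℝ)) := by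
      rw [← Complex.exp_add, Complex.ofReal_exp]
      congr 1
      push_cast
      field_simp
      ring
    have hc1 : ((y * t : ℝ) : ℂ) ^ (s - 1) = (y : ℂ) ^ (s - 1) * (t : ℂ) ^ (s - 1) := by
      rw [Complex.ofReal_mul, Complex.mul_cpow_ofReal_nonneg hy.le ht.le]
    have hc2 (z : ℂ) : ((Real.pi * (y * t) : ℝ) : ℂ) ^ z =
        (Real.pi : ℂ) ^ z * ((y : ℂ) ^ z * (t : ℂ) ^ z) := by
      rw [Complex.ofReal_mul, Complex.mul_cpow_ofReal_nonneg Real.pi_pos.le (by positivity),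
        Complex.ofReal_mul, Complex.mul_cpow_ofReal_nonneg hy.le ht.le]
    have hp : (Real.pi : ℂ) ^ (-((L : ℂ) - j + 1 / 2)) =
        (Real.pi : ℂ) ^ (-((L : ℂ) + 1 / 2)) * (Real.pi : ℂ) ^ j := by
      rw [← Complex.cpow_natCast, ← Complex.cpow_add _ _ hpi]
      congr 1
      ring
    have hyy : (y : ℂ) * ((y : ℂ) ^ (s - 1) * (y : ℂ) ^ (-((L : ℂ) - j + 1 / 2))) =
        (y : ℂ) ^ (ν + j) := by
      nth_rewrite 1 [← Complex.cpow_one (y : ℂ)]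
      rw [← Complex.cpow_add _ _ hy', ← Complex.cpow_add _ _ hy']
      congr 1
      rw [hs]
      ring
    have htt : (t : ℂ) ^ (s - 1) * (t : ℂ) ^ (-((L : ℂ) - j + 1 / 2)) =
        (t : ℂ) ^ (ν - 1) * (t : ℂ) ^ j := by
      rw [← Complex.cpow_natCast, ← Complex.cpow_add _ _ ht', ← Complex.cpow_add _ _ ht']
      congr 1
      rw [hs]
      ring
    rw [sqrt_add_div_sqrt_pow_two_mul ht hjE, hexp, hc1, hc2, hp, ← hyy,
      show y / (y * t) = 1 / t by field_simp, neg_pow (Real.pi : ℂ) j, Complex.ofReal_mul (t ^ j),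
      Complex.ofReal_pow t j]
    linear_combination ((y : ℂ) * ((y : ℂ) ^ (s - 1) * (y : ℂ) ^ (-((L : ℂ) - j + 1 / 2))) *
      Complex.exp (-(Real.pi * (y * t) : ℝ)) *
      Complex.exp (-(Real.pi * y ^ 2 / (y * t) : ℝ)) * ((2 * L).choose (2 * j) : ℂ) * (-1) ^ j *
      (((1 / t + E) ^ (2 * j) : ℝ) : ℂ) * Complex.Gamma ((L : ℂ) - j + 1 / 2) *
      ((Real.pi : ℂ) ^ (-((L : ℂ) + 1 / 2)) * (Real.pi : ℂ) ^ j)) * htt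
  rw [hsubst, setIntegral_congr_fun measurableSet_Ioi hpt, integral_finsetSum _ fun j _ =>
    (integrableOn_cpow_mul_sqrt_add_pow_mul_exp hν (mul_pos Real.pi_pos hy) hE j).const_mul _,
    Finset.mul_sum, Finset.mul_sum]
  refine Finset.sum_congr rfl fun j _ => ?_
  have hps : (Real.pi : ℂ) ^ ν = (Real.pi : ℂ) ^ s * (Real.pi : ℂ) ^ (-((L : ℂ) + 1 / 2)) := by
    rw [← Complex.cpow_add _ _ hpi]
    congr 1
    rw [hs]
    ring
  rw [integral_const_mul, hps]
  ring

theorem cpow_mul_div_pow_eq (ν : ℂ) (ξ : ℝ) {e : ℤ} (he : e = 1 ∨ e = -1) (L : ℕ) :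
    ((ξ ^ 2 + 1 : ℝ) : ℂ) ^ (-ν - 1 / 2) *
        (((ξ : ℂ) - Complex.I) / ((ξ : ℂ) + Complex.I)) ^ (e * L) =
      ((ξ ^ 2 + 1 : ℝ) : ℂ) ^ (-(ν + L + 1 / 2)) *
        ((ξ : ℂ) - (e : ℝ) * Complex.I) ^ (2 * L) := by
  have hX : ((ξ ^ 2 + 1 : ℝ) : ℂ) ≠ 0 := by
    exact_mod_cast (by positivity : 0 < ξ ^ 2 + 1).ne'
  have hfac : ((ξ ^ 2 + 1 : ℝ) : ℂ) = ((ξ : ℂ) - Complex.I) * ((ξ : ℂ) + Complex.I) := by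
    push_cast
    linear_combination Complex.I_sq
  have hm : (ξ : ℂ) - Complex.I ≠ 0 := fun h => hX (by rw [hfac, h, zero_mul])
  have hp : (ξ : ℂ) + Complex.I ≠ 0 := fun h => hX (by rw [hfac, h, mul_zero])
  have hc : ((ξ ^ 2 + 1 : ℝ) : ℂ) ^ (-ν - 1 / 2) =
      ((ξ ^ 2 + 1 : ℝ) : ℂ) ^ (-(ν + L + 1 / 2)) * ((ξ ^ 2 + 1 : ℝ) : ℂ) ^ L := by
    rw [← Complex.cpow_natCast, ← Complex.cpow_add _ _ hX]
    congr 1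
    ring
  rw [hc, mul_assoc]
  congr 1
  rw [hfac]
  rcases he with rfl | rfl
  · simp only [one_mul, zpow_natCast, Int.cast_one, Complex.ofReal_one]
    rw [← mul_pow, pow_mul]
    congr 1
    field_simp
  · simp only [neg_mul, one_mul, zpow_neg, zpow_natCast, Int.cast_neg, Int.cast_one,
      Complex.ofReal_neg, Complex.ofReal_one, sub_neg_eq_add]
    rw [← inv_pow, ← mul_pow, pow_mul]
    congr 1
    field_simp

/-- Explicit evaluation of the Jacquet integral of a weight function. -/
theorem jacquet_integral_eval (δ : ℤ) (hδ : δ = 1 ∨ δ = -1) (ℓ : ℤ) (y : ℝ) (hy : 0 < y)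
    (ν : ℂ) (hν : 0 < ν.re) :
    Integrable (fun ξ : ℝ =>
      Complex.exp (-2 * (Real.pi : ℂ) * Complex.I * (y : ℂ) * (ξ : ℂ)) *
        ((ξ ^ 2 + 1 : ℝ) : ℂ) ^ (-ν - 1 / 2) *
        (((ξ : ℂ) - Complex.I) / ((ξ : ℂ) + Complex.I)) ^ (δ * ℓ)) ∧
    (∀ j : ℕ, j ≤ ℓ.natAbs →
      IntegrableOn (fun t : ℝ =>
        (t : ℂ) ^ (ν - 1) *
          (((Real.sqrt t + (δ : ℝ) * ((ℓ.sign : ℤ) : ℝ) / Real.sqrt t) ^ (2 * j) : ℝ) : ℂ) *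
          (Real.exp (-(Real.pi * y * (t + 1 / t))) : ℂ)) (Set.Ioi 0)) ∧
    (∫ ξ : ℝ,
        Complex.exp (-2 * (Real.pi : ℂ) * Complex.I * (y : ℂ) * (ξ : ℂ)) *
          ((ξ ^ 2 + 1 : ℝ) : ℂ) ^ (-ν - 1 / 2) *
          (((ξ : ℂ) - Complex.I) / ((ξ : ℂ) + Complex.I)) ^ (δ * ℓ)) =
      (Real.pi : ℂ) ^ ν / Complex.Gamma (ν + (ℓ.natAbs : ℂ) + 1 / 2) *
        ∑ j ∈ Finset.range (ℓ.natAbs + 1),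
          (-(Real.pi : ℂ)) ^ j * ((2 * ℓ.natAbs).choose (2 * j) : ℂ) *
            Complex.Gamma ((ℓ.natAbs : ℂ) - (j : ℂ) + 1 / 2) * (y : ℂ) ^ (ν + (j : ℂ)) *
            ∫ t in Set.Ioi (0 : ℝ),
              (t : ℂ) ^ (ν - 1) *
                (((Real.sqrt t + (δ : ℝ) * ((ℓ.sign : ℤ) : ℝ) / Real.sqrt t) ^ (2 * j) : ℝ) : ℂ) *
                (Real.exp (-(Real.pi * y * (t + 1 / t))) : ℂ) := by
  obtain ⟨e, he, hel, hes⟩ : ∃ e : ℤ, (e = 1 ∨ e = -1) ∧ δ * ℓ = e * ℓ.natAbs ∧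
      (ℓ ≠ 0 → δ * ℓ.sign = e) := by
    rcases lt_trichotomy ℓ 0 with h | rfl | h
    · refine ⟨-δ, by omega, ?_, fun _ => by simp [Int.sign_eq_neg_one_of_neg h]⟩
      rw [Int.ofNat_natAbs_of_nonpos h.le, neg_mul_neg]
    · exact ⟨1, by simp, by simp, by simp⟩
    · exact ⟨δ, hδ, by rw [Int.natAbs_of_nonneg h.le],
        fun _ => by simp [Int.sign_eq_one_of_pos h]⟩
  have hEabs : |(δ : ℝ) * ((ℓ.sign : ℤ) : ℝ)| ≤ 1 := by
    rcases eq_or_ne ℓ 0 with rfl | h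
    · simp
    · rw [← Int.cast_mul, hes h]
      rcases he with rfl | rfl <;> simp
  have hEsq : ℓ.natAbs = 0 ∨ ((δ : ℝ) * ((ℓ.sign : ℤ) : ℝ)) ^ 2 = 1 := by
    rcases eq_or_ne ℓ 0 with rfl | h
    · simp
    · rw [← Int.cast_mul, hes h]
      rcases he with rfl | rfl <;> simp
  have hpt : ∀ ξ : ℝ,
      Complex.exp (-2 * (Real.pi : ℂ) * Complex.I * (y : ℂ) * (ξ : ℂ)) *
        ((ξ ^ 2 + 1 : ℝ) : ℂ) ^ (-ν - 1 / 2) *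
        (((ξ : ℂ) - Complex.I) / ((ξ : ℂ) + Complex.I)) ^ (δ * ℓ) =
      Complex.exp (-2 * (Real.pi : ℂ) * Complex.I * (y : ℂ) * (ξ : ℂ)) *
        (((ξ ^ 2 + 1 : ℝ) : ℂ) ^ (-(ν + ℓ.natAbs + 1 / 2)) *
          ((ξ : ℂ) - ((δ : ℝ) * ((ℓ.sign : ℤ) : ℝ) : ℝ) * Complex.I) ^ (2 * ℓ.natAbs)) := by
    intro ξ
    rw [mul_assoc, hel, cpow_mul_div_pow_eq ν ξ he]
    rcases eq_or_ne ℓ 0 with rfl | h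
    · simp
    · rw [← Int.cast_mul, hes h]
  refine ⟨?_, fun j _ =>
    integrableOn_cpow_mul_sqrt_add_pow_mul_exp hν (mul_pos Real.pi_pos hy) hEabs j, ?_⟩
  · refine Integrable.mono' (integrable_sq_add_one_rpow hν)
      (Measurable.aestronglyMeasurable ?_) (.of_forall fun ξ => le_of_eq ?_)
    · simp only [hpt]
      fun_prop
    · have hX : 0 < ξ ^ 2 + 1 := by positivity
      have h1 : ‖((ξ : ℂ) - Complex.I) / ((ξ : ℂ) + Complex.I)‖ = 1 := by
        have h2 : (ξ : ℂ) - Complex.I = (starRingEnd ℂ) ((ξ : ℂ) + Complex.I) := by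
          simp [sub_eq_add_neg]
        have h3 : ‖(ξ : ℂ) + Complex.I‖ ≠ 0 := by
          refine norm_ne_zero_iff.mpr fun h => ?_
          simpa using congrArg Complex.im h
        rw [norm_div, h2, Complex.norm_conj, div_self h3]
      rw [norm_mul, norm_mul, norm_cexp_neg_two_pi_I_mul, norm_zpow, h1, one_zpow, one_mul,
        mul_one, Complex.norm_cpow_eq_rpow_re_of_pos hX]
      simp
  · simp only [hpt]
    exact integral_cexp_mul_cpow_mul_pow hν hy hEabs _ hEsq
end

section
/- Special values of the Jacquet integral at ν = l − 1/2: let l ≥ 1 be an integer, δ ∈ {+1,−1}, ℓ ∈ ℤ and y > 0. Then ∫_{−∞}^{∞} e^{−2πiyξ} (ξ²+1)^{−l} ((ξ−i)/(ξ+i))^{δℓ} dξ equals 0 whenever δℓ ≤ −l, and equals (−1)^l · (2π)^{2l} / Γ(2l) · y^{2l−1} · e^{−2πy} whenever δℓ = l. -/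
open MeasureTheory

theorem integrableOn_pow_mul_cexp_neg_mul_Ioi (n : ℕ) {c : ℂ} (hc : 0 < c.re) :
    IntegrableOn (fun t : ℝ => (t : ℂ) ^ n * Complex.exp (-(c * t))) (Set.Ioi 0) := by
  have h := integrableOn_rpow_mul_exp_neg_mul_rpow (p := 1) (s := n) (b := c.re)
    (by linarith [(Nat.cast_nonneg n : (0:ℝ) ≤ n)]) one_pos hc
  refine Integrable.mono' h (Continuous.aestronglyMeasurable (by fun_prop)) ?_
  filter_upwards [ae_restrict_mem measurableSet_Ioi] with t ht
  have ht' : 0 < t := ht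
  simp [Complex.norm_exp, abs_of_pos ht']

theorem integral_pow_mul_cexp_neg_mul_Ioi (n : ℕ) {c : ℂ} (hc : 0 < c.re) :
    ∫ t : ℝ in Set.Ioi 0, (t : ℂ) ^ n * Complex.exp (-(c * t)) = n.factorial / c ^ (n + 1) := by
  have hc0 : c ≠ 0 := by rintro rfl; simp at hc
  induction n with
  | zero =>
    have := integral_exp_mul_complex_Ioi (a := -c) (by simpa using hc) 0
    simpa [neg_mul] using this
  | succ n ih =>
    have hd : ∀ t ∈ Set.Ioi (0 : ℝ), HasDerivAt
        (fun t : ℝ => -((t : ℂ) ^ (n + 1) * Complex.exp (-(c * t))) / c)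
        ((t : ℂ) ^ (n + 1) * Complex.exp (-(c * t))
          - (n + 1) / c * ((t : ℂ) ^ n * Complex.exp (-(c * t)))) t := by
      intro t _
      have h1 : HasDerivAt (fun t : ℝ => (t : ℂ)) 1 t := Complex.ofRealCLM.hasDerivAt
      convert! (((h1.pow (n + 1)).mul ((h1.const_mul c).neg.cexp)).neg.div_const c) using 1
      simp
      field_simp
      ring
    have hi := integrableOn_pow_mul_cexp_neg_mul_Ioi n hc
    have hi' := integrableOn_pow_mul_cexp_neg_mul_Ioi (n + 1) hc
    have ht : Filter.Tendsto (fun t : ℝ => -((t : ℂ) ^ (n + 1) * Complex.exp (-(c * t))) / c)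
        Filter.atTop (nhds 0) := by
      rw [tendsto_zero_iff_norm_tendsto_zero]
      have := (tendsto_rpow_mul_exp_neg_mul_atTop_nhds_zero
        ((n + 1 : ℕ) : ℝ) c.re hc).div_const ‖c‖
      rw [zero_div] at this
      refine this.congr' ?_
      filter_upwards [Filter.eventually_gt_atTop 0] with t ht
      rw [Real.rpow_natCast]
      simp [Complex.norm_exp, abs_of_pos ht]
    have h := integral_Ioi_of_hasDerivAt_of_tendsto (a := 0)
      (Continuous.continuousWithinAt (by fun_prop)) hd (hi'.sub (hi.const_mul _)) ht
    rw [integral_sub hi' (hi.const_mul _), integral_const_mul, ih] at h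
    rw [sub_eq_iff_eq_add.mp h, Nat.factorial_succ]
    push_cast
    simp
    field_simp
    ring

theorem integrable_one_add_mul_I_pow_inv {k : ℕ} (hk : 2 ≤ k) :
    Integrable (fun ξ : ℝ => ((1 + (ξ : ℂ) * Complex.I) ^ k)⁻¹) := by
  have h0 (ξ : ℝ) : 1 + (ξ : ℂ) * Complex.I ≠ 0 := fun h => by
    simpa using congrArg Complex.re h
  have hn (ξ : ℝ) : ‖1 + (ξ : ℂ) * Complex.I‖ ^ 2 = 1 + ξ ^ 2 := by
    rw [Complex.sq_norm, Complex.normSq_apply]; simp; ring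
  refine integrable_inv_one_add_sq.mono' (Continuous.aestronglyMeasurable
    (Continuous.inv₀ (by fun_prop) fun ξ => pow_ne_zero _ (h0 ξ))) (ae_of_all _ fun ξ => ?_)
  have : (1 : ℝ) ≤ ‖1 + (ξ : ℂ) * Complex.I‖ ^ 2 := by rw [hn]; nlinarith
  have h1 : 1 ≤ ‖1 + (ξ : ℂ) * Complex.I‖ := by
    nlinarith [norm_nonneg (1 + (ξ : ℂ) * Complex.I)]
  rw [norm_inv, norm_pow, ← hn]
  gcongr

/-- The function `x ^ n * exp (-2πx)` on the positive half-line, extended by zero. -/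
noncomputable def powExpIndicator (n : ℕ) : ℝ → ℂ :=
  (Set.Ioi 0).indicator fun t => (t : ℂ) ^ n * Complex.exp (-(2 * Real.pi * t))

open FourierTransform in
theorem fourier_powExpIndicator (n : ℕ) (ξ : ℝ) :
    𝓕 (powExpIndicator n) ξ =
      n.factorial / (2 * Real.pi) ^ (n + 1) * ((1 + (ξ : ℂ) * Complex.I) ^ (n + 1))⁻¹ := by
  have hc : 0 < (2 * Real.pi * (1 + (ξ : ℂ) * Complex.I)).re := by
    simp [Real.pi_pos]
  rw [Real.fourier_real_eq_integral_exp_smul, ← div_eq_mul_inv, div_div, ← mul_pow,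
    ← integral_pow_mul_cexp_neg_mul_Ioi n hc, ← integral_indicator measurableSet_Ioi]
  congr 1 with t
  by_cases ht : t ∈ Set.Ioi (0 : ℝ)
  · simp only [powExpIndicator, Set.indicator_of_mem ht, smul_eq_mul]
    rw [mul_left_comm, ← Complex.exp_add]
    congr 2
    push_cast
    ring
  · simp [powExpIndicator, Set.indicator_of_notMem ht]

theorem integrable_powExpIndicator (n : ℕ) : Integrable (powExpIndicator n) :=
  (integrable_indicator_iff measurableSet_Ioi).2 <| by
    simpa using integrableOn_pow_mul_cexp_neg_mul_Ioi n (c := 2 * Real.pi)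
      (by simp [Real.pi_pos])

theorem integral_cexp_mul_one_add_mul_I_pow_inv {n : ℕ} (hn : 1 ≤ n) {x : ℝ} (hx : x ≠ 0) :
    ∫ ξ : ℝ, Complex.exp (2 * Real.pi * x * ξ * Complex.I) *
        ((1 + (ξ : ℂ) * Complex.I) ^ (n + 1))⁻¹ =
      (2 * Real.pi) ^ (n + 1) / n.factorial * powExpIndicator n x := by
  have hcont : ContinuousAt (powExpIndicator n) x := by
    have : ContinuousAt (fun t : ℝ => (t : ℂ) ^ n * Complex.exp (-(2 * Real.pi * t))) x := by
      fun_prop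
    rcases lt_or_gt_of_ne hx with h | h
    · refine (continuousAt_const : ContinuousAt (fun _ : ℝ => (0 : ℂ)) x).congr ?_
      filter_upwards [Iio_mem_nhds h] with t ht
      rw [powExpIndicator, Set.indicator_of_notMem (Set.notMem_Ioi.2 (le_of_lt ht))]
    · refine this.congr ?_
      filter_upwards [Ioi_mem_nhds h] with t ht
      rw [powExpIndicator, Set.indicator_of_mem (Set.mem_Ioi.2 ht)]
  have hF := funext (fourier_powExpIndicator n)
  have h := (integrable_powExpIndicator n).fourierInv_fourier_eq
    (by rw [hF]; exact (integrable_one_add_mul_I_pow_inv (by omega)).const_mul _) hcont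
  rw [← h, hF, Real.fourierInv_eq', ← integral_const_mul]
  congr 1 with ξ
  have : (n.factorial : ℂ) ≠ 0 := by exact_mod_cast n.factorial_ne_zero
  have hpi : (Real.pi : ℂ) ≠ 0 := by exact_mod_cast Real.pi_ne_zero
  have h0 : 1 + (ξ : ℂ) * Complex.I ≠ 0 := fun h => by
    simpa using congrArg Complex.re h
  simp only [smul_eq_mul, RCLike.inner_apply, conj_trivial]
  push_cast
  rw [show (2 * Real.pi * (x * ξ) * Complex.I : ℂ) = 2 * Real.pi * x * ξ * Complex.I by ring]
  field_simp

theorem add_I_ne_zero (ξ : ℝ) : (ξ : ℂ) + Complex.I ≠ 0 := fun h => by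
  simpa using congrArg Complex.im h

theorem sub_I_ne_zero (ξ : ℝ) : (ξ : ℂ) - Complex.I ≠ 0 := fun h => by
  simpa using congrArg Complex.im h

theorem ofReal_sq_add_one_zpow_neg_mul (l m : ℤ) (ξ : ℝ) :
    (((ξ ^ 2 + 1) ^ (-l) : ℝ) : ℂ) * (((ξ : ℂ) - Complex.I) / ((ξ : ℂ) + Complex.I)) ^ m =
      ((ξ : ℂ) + Complex.I) ^ (-l - m) * ((ξ : ℂ) - Complex.I) ^ (m - l) := by
  have ha := add_I_ne_zero ξ
  have hs := sub_I_ne_zero ξ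
  have : (((ξ ^ 2 + 1 : ℝ)) : ℂ) = ((ξ : ℂ) + Complex.I) * ((ξ : ℂ) - Complex.I) := by
    push_cast
    linear_combination Complex.I_sq
  rw [Complex.ofReal_zpow, this, mul_zpow, div_zpow, sub_eq_add_neg (-l), zpow_add₀ ha,
    show m - l = -l + m by ring, zpow_add₀ hs, zpow_neg _ m]
  field_simp

theorem one_add_mul_I_pow_inv (k : ℕ) (ξ : ℝ) :
    ((1 + (ξ : ℂ) * Complex.I) ^ k)⁻¹ = (Complex.I ^ k)⁻¹ * (((ξ : ℂ) - Complex.I) ^ k)⁻¹ := by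
  rw [← mul_inv, ← mul_pow]
  congr 2
  linear_combination Complex.I_sq

theorem integrable_sub_I_pow_inv {k : ℕ} (hk : 2 ≤ k) :
    Integrable (fun ξ : ℝ => (((ξ : ℂ) - Complex.I) ^ k)⁻¹) := by
  refine ((integrable_one_add_mul_I_pow_inv hk).const_mul (Complex.I ^ k)).congr
    (ae_of_all _ fun ξ => ?_)
  simp [one_add_mul_I_pow_inv]

theorem integrable_cexp_mul_sub_I_pow_inv (y : ℝ) {k : ℕ} (hk : 2 ≤ k) :
    Integrable (fun ξ : ℝ => Complex.exp (-2 * Real.pi * Complex.I * y * ξ) *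
      (((ξ : ℂ) - Complex.I) ^ k)⁻¹) := by
  refine (integrable_sub_I_pow_inv hk).bdd_mul (c := 1)
    (Continuous.aestronglyMeasurable (by fun_prop)) (ae_of_all _ fun ξ => ?_)
  simp [Complex.norm_exp]

theorem integral_cexp_mul_sub_I_pow_inv {y : ℝ} (hy : 0 < y) {k : ℕ} (hk : 2 ≤ k) :
    ∫ ξ : ℝ, Complex.exp (-2 * Real.pi * Complex.I * y * ξ) *
      (((ξ : ℂ) - Complex.I) ^ k)⁻¹ = 0 := by
  obtain ⟨n, rfl⟩ := Nat.exists_eq_add_of_le' (show 1 ≤ k by omega)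
  have h := integral_cexp_mul_one_add_mul_I_pow_inv (n := n) (by omega) (neg_ne_zero.2 hy.ne')
  have h0 : powExpIndicator n (-y) = 0 := Set.indicator_of_notMem (by simpa using hy.le) _
  rw [h0, mul_zero] at h
  calc _ = ∫ ξ : ℝ, Complex.I ^ (n + 1) * (Complex.exp (2 * Real.pi * (-y : ℝ) * ξ * Complex.I) *
          ((1 + (ξ : ℂ) * Complex.I) ^ (n + 1))⁻¹) := by
        congr 1 with ξ
        rw [one_add_mul_I_pow_inv, mul_left_comm,
          mul_inv_cancel_left₀ (pow_ne_zero _ Complex.I_ne_zero)]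
        congr 2
        push_cast
        ring
    _ = 0 := by rw [integral_const_mul, h, mul_zero]

theorem integral_cexp_mul_add_I_pow_mul_sub_I_pow_inv {y : ℝ} (hy : 0 < y) (n : ℕ) {k : ℕ}
    (hk : n + 2 ≤ k) :
    ∫ ξ : ℝ, Complex.exp (-2 * Real.pi * Complex.I * y * ξ) *
      (((ξ : ℂ) + Complex.I) ^ n * (((ξ : ℂ) - Complex.I) ^ k)⁻¹) = 0 := by
  have hexp (ξ : ℝ) : Complex.exp (-2 * Real.pi * Complex.I * y * ξ) *
      (((ξ : ℂ) + Complex.I) ^ n * (((ξ : ℂ) - Complex.I) ^ k)⁻¹) =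
      ∑ j ∈ Finset.range (n + 1), ((2 * Complex.I) ^ (n - j) * n.choose j) *
        (Complex.exp (-2 * Real.pi * Complex.I * y * ξ) * (((ξ : ℂ) - Complex.I) ^ (k - j))⁻¹) := by
    rw [show (ξ : ℂ) + Complex.I = (ξ - Complex.I) + 2 * Complex.I by ring, add_pow,
      Finset.sum_mul, Finset.mul_sum]
    refine Finset.sum_congr rfl fun j hj => ?_
    have hj := Finset.mem_range.1 hj
    have hs := sub_I_ne_zero ξ
    rw [pow_sub₀ _ hs (by omega : j ≤ k)]
    field_simp
  simp_rw [hexp]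
  rw [integral_finsetSum]
  · refine Finset.sum_eq_zero fun j hj => ?_
    have hj := Finset.mem_range.1 hj
    rw [integral_const_mul, integral_cexp_mul_sub_I_pow_inv hy (by omega), mul_zero]
  · intro j hj
    have hj := Finset.mem_range.1 hj
    exact (integrable_cexp_mul_sub_I_pow_inv y (by omega)).const_mul _

theorem integral_cexp_mul_add_I_pow_inv {y : ℝ} (hy : 0 < y) {n : ℕ} (hn : 1 ≤ n) :
    ∫ ξ : ℝ, Complex.exp (-2 * Real.pi * Complex.I * y * ξ) *
      (((ξ : ℂ) + Complex.I) ^ (n + 1))⁻¹ =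
      (-2 * Real.pi * Complex.I) ^ (n + 1) / n.factorial * y ^ n *
        Complex.exp (-2 * Real.pi * y) := by
  have h := integral_cexp_mul_one_add_mul_I_pow_inv hn hy.ne'
  have hp : powExpIndicator n y = (y : ℂ) ^ n * Complex.exp (-(2 * Real.pi * y)) :=
    Set.indicator_of_mem (Set.mem_Ioi.2 hy) _
  rw [hp, ← integral_neg_eq_self] at h
  calc _ = ∫ ξ : ℝ, (-Complex.I) ^ (n + 1) *
          (Complex.exp (2 * Real.pi * y * (-ξ : ℝ) * Complex.I) *
          ((1 + ((-ξ : ℝ) : ℂ) * Complex.I) ^ (n + 1))⁻¹) := by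
        congr 1 with ξ
        have : 1 + ((-ξ : ℝ) : ℂ) * Complex.I = -Complex.I * (ξ + Complex.I) := by
          push_cast
          linear_combination Complex.I_sq
        rw [this, mul_pow, mul_inv, mul_left_comm,
          mul_inv_cancel_left₀ (pow_ne_zero _ (neg_ne_zero.2 Complex.I_ne_zero))]
        congr 2
        push_cast
        ring
    _ = _ := by
        rw [integral_const_mul, h, show (-2 * Real.pi * Complex.I : ℂ) =
          -Complex.I * (2 * Real.pi) by ring, mul_pow (-Complex.I), neg_mul 2 (Real.pi : ℂ),
          neg_mul]
        ring

/-- Special values of the Jacquet integral at ν = l − 1/2. -/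
theorem jacquet_integral_special_values (l : ℕ) (hl : 1 ≤ l) (δ : ℤ) (hδ : δ = 1 ∨ δ = -1)
    (ℓ : ℤ) (y : ℝ) (hy : 0 < y) :
    (δ * ℓ ≤ -(l : ℤ) →
      (∫ ξ : ℝ,
          Complex.exp (-2 * (Real.pi : ℂ) * Complex.I * (y : ℂ) * (ξ : ℂ)) *
            (((ξ ^ 2 + 1) ^ (-(l : ℤ)) : ℝ) : ℂ) *
            (((ξ : ℂ) - Complex.I) / ((ξ : ℂ) + Complex.I)) ^ (δ * ℓ)) = 0) ∧
    (δ * ℓ = (l : ℤ) →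
      (∫ ξ : ℝ,
          Complex.exp (-2 * (Real.pi : ℂ) * Complex.I * (y : ℂ) * (ξ : ℂ)) *
            (((ξ ^ 2 + 1) ^ (-(l : ℤ)) : ℝ) : ℂ) *
            (((ξ : ℂ) - Complex.I) / ((ξ : ℂ) + Complex.I)) ^ (δ * ℓ)) =
        (((-1) ^ l * (2 * Real.pi) ^ (2 * l) / Real.Gamma (2 * l) * y ^ (2 * l - 1) *
            Real.exp (-2 * Real.pi * y) : ℝ) : ℂ)) := by
  simp_rw [mul_assoc (Complex.exp _), ofReal_sq_add_one_zpow_neg_mul]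
  refine ⟨fun h => ?_, fun h => ?_⟩
  · obtain ⟨n, hn⟩ := Int.le.dest h
    rw [show -(l : ℤ) - δ * ℓ = (n : ℤ) by omega,
      show δ * ℓ - (l : ℤ) = -((n + 2 * l : ℕ) : ℤ) by push_cast; omega]
    simp_rw [zpow_neg, zpow_natCast]
    exact integral_cexp_mul_add_I_pow_mul_sub_I_pow_inv hy n (by omega)
  · obtain ⟨n, hn⟩ := Nat.exists_eq_add_of_le' (show 1 ≤ 2 * l by omega)
    have hG : Real.Gamma (2 * l) = n.factorial := by
      rw [← Real.Gamma_nat_eq_factorial]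
      congr 1
      exact_mod_cast hn
    rw [h, sub_self, show -(l : ℤ) - l = -((n + 1 : ℕ) : ℤ) by omega]
    simp_rw [zpow_neg, zpow_natCast, zpow_zero, mul_one]
    have hI : (-2 * Real.pi * Complex.I : ℂ) ^ (2 * l) = (-1) ^ l * (2 * Real.pi) ^ (2 * l) := by
      rw [pow_mul, pow_mul, ← mul_pow]
      congr 1
      linear_combination 4 * (Real.pi : ℂ) ^ 2 * Complex.I_sq
    rw [integral_cexp_mul_add_I_pow_inv hy (by omega), ← hn, hI, hG,
      show 2 * l - 1 = n by omega]
    push_cast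
    rfl
end
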